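/- arXiv:1301.3608 — 3 statements merged into one kernel-verified Lean document; each statement's English description precedes it below -/
import Mathlib

section
/- Let d, s ≥ 0 and N ≥ 0 be integers with d(q−1) > s + ℓ_q(N). Then ∑_{a ∈ A⁺(d)} a(t₁)⋯a(t_s)·a^N = 0 in A[t₁,…,t_s], where a^N ∈ A appears as a constant (coefficient) factor. -/
/-- The monic polynomial of degree `d` over `F` with lower-order coefficients
given by `c : Fin d → F`: `X^d + ∑_{i<d} c i * X^i`.
As `c` ranges over `Fin d → F`, this enumerates the set `A⁺(d)` of monic
polynomials of degree `d` in `A = F[θ]`. -/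
noncomputable def monicOf (F : Type*) [Field F] (d : ℕ) (c : Fin d → F) : Polynomial F :=
  Polynomial.X ^ d + ∑ i : Fin d, Polynomial.C (c i) * Polynomial.X ^ (i : ℕ)

/-- `ℓ_q(n)`: the sum of the digits of `n` in base `q`. -/
def lq (q n : ℕ) : ℕ := (Nat.digits q n).sum

open Polynomial in
/-- Every power `a ^ N` of a polynomial over a finite field is a product of values of `a`, one for
each unit of each base-`q` digit of `N`. -/
theorem exists_pow_ofDigits_eq_prod_aeval (F : Type*) [Field F] [Fintype F] (L : List ℕ) :
    ∃ x : Fin L.sum → F[X], ∀ a : F[X],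
      a ^ Nat.ofDigits (Fintype.card F) L = ∏ k, aeval (x k) a := by
  induction L with
  | nil => exact ⟨Fin.elim0, fun a => by rw [Nat.ofDigits_nil, pow_zero]; exact Fin.prod_univ_zero _ |>.symm⟩
  | cons r L ih =>
    obtain ⟨x, hx⟩ := ih
    rw [List.sum_cons]
    refine ⟨Fin.append (fun _ => X) (fun k => x k ^ Fintype.card F), fun a => ?_⟩
    have hfrob (k : Fin L.sum) :
        aeval (x k ^ Fintype.card F) a = aeval (x k) a ^ Fintype.card F := by
      simpa using aeval_algHom_apply (FiniteField.frobeniusAlgHom F F[X]) (x k) a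
    simp [Nat.ofDigits_cons, Fin.prod_univ_add, pow_add, pow_mul', hx, hfrob, Finset.prod_pow]

/-- A product of fewer than `d * (q - 1)` values of the generic monic polynomial of degree `d`
sums to zero over all choices of the lower-order coefficients. -/
theorem sum_prod_aeval_monicOf_eq_zero {F R : Type*} [Field F] [Fintype F] [CommRing R]
    [Algebra F R] {d m : ℕ} (h : m < d * (Fintype.card F - 1)) (x : Fin m → R) :
    ∑ c : Fin d → F, ∏ k, Polynomial.aeval (x k) (monicOf F d c) = 0 := by
  classical
  let u : Option (Fin d) → MvPolynomial (Fin d) F := fun i => i.elim 1 MvPolynomial.X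
  let e : Option (Fin d) → ℕ := fun i => i.elim d (fun j => j)
  have hu (i : Option (Fin d)) : (u i).totalDegree ≤ 1 := by
    cases i <;> simp [u]
  have haeval (c : Fin d → F) (k : Fin m) : Polynomial.aeval (x k) (monicOf F d c) =
      ∑ i, MvPolynomial.eval c (u i) • x k ^ e i := by
    simp [monicOf, u, e, Fintype.sum_option, Algebra.smul_def]
  simp_rw [haeval, Fintype.prod_sum, Finset.prod_smul]
  rw [Finset.sum_comm]
  refine Finset.sum_eq_zero fun g _ => ?_
  simp_rw [← Finset.sum_smul, ← map_prod]
  rw [MvPolynomial.sum_eval_eq_zero, zero_smul]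
  calc (∏ k, u (g k)).totalDegree ≤ ∑ k, (u (g k)).totalDegree :=
        MvPolynomial.totalDegree_finsetProd _ _
    _ ≤ ∑ _k : Fin m, 1 := Finset.sum_le_sum fun k _ => hu (g k)
    _ < (Fintype.card F - 1) * Fintype.card (Fin d) := by simpa [mul_comm] using h

/-- If `d(q−1) > s + ℓ_q(N)`, then `∑_{a ∈ A⁺(d)} a(t₁) ⋯ a(t_s) · a^N = 0`
in `A[t₁,…,t_s]`, where `a^N ∈ A` appears as a constant factor. -/
theorem sum_monic_pow_eq_zero (F : Type*) [Field F] [Fintype F] (q : ℕ)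
    (hq : Fintype.card F = q) (d s N : ℕ) (h : s + lq q N < d * (q - 1)) :
    (∑ c : Fin d → F,
        MvPolynomial.C ((monicOf F d c) ^ N) *
          ∏ i : Fin s, Polynomial.aeval (MvPolynomial.X i) (monicOf F d c)) =
      (0 : MvPolynomial (Fin s) (Polynomial F)) := by
  subst hq
  obtain ⟨x, hx⟩ := exists_pow_ofDigits_eq_prod_aeval F (Nat.digits (Fintype.card F) N)
  rw [Nat.ofDigits_digits] at hx
  have hC (k) (a : Polynomial F) : MvPolynomial.C (Polynomial.aeval (x k) a) =
      Polynomial.aeval (MvPolynomial.C (x k) : MvPolynomial (Fin s) (Polynomial F)) a :=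
    (Polynomial.aeval_algHom_apply
      (IsScalarTower.toAlgHom F (Polynomial F) (MvPolynomial (Fin s) (Polynomial F))) (x k) a).symm
  rw [← sum_prod_aeval_monicOf_eq_zero h
    (Fin.append MvPolynomial.X fun k => MvPolynomial.C (x k))]
  refine Finset.sum_congr rfl fun c _ => ?_
  rw [Fin.prod_univ_add, hx, map_prod, mul_comm]
  simp only [Fin.append_left, Fin.append_right, hC]
  rfl
end

section
/- For all integers s ≥ 1, α ≥ 1 and k ≥ 0, the polynomial ∑_{d=0}^{k} S_{d,s}(−α) ∈ K[t₁,…,t_s] has total degree exactly ks. -/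
/-- `S_{d,s}(−α) = ∑_{a ∈ A⁺(d)} a(t₁) ⋯ a(t_s) · a^{−α} ∈ K[t₁,…,t_s]`, where
`K = F(θ)` and `a(t_i)` is the image of `a` under the algebra map sending `θ` to `t_i`. -/
noncomputable def SdsK (F : Type*) [Field F] [Fintype F] (d s α : ℕ) :
    MvPolynomial (Fin s) (RatFunc F) :=
  ∑ c : Fin d → F,
    MvPolynomial.C ((algebraMap (Polynomial F) (RatFunc F) (monicOf F d c))⁻¹ ^ α) *
      ∏ i : Fin s, Polynomial.aeval (MvPolynomial.X i) (monicOf F d c)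

open Polynomial in
theorem FiniteField.exists_monic_irreducible_natDegree_eq (F : Type*) [Field F] [Finite F]
    {n : ℕ} (hn : n ≠ 0) : ∃ P : F[X], P.Monic ∧ Irreducible P ∧ P.natDegree = n := by
  obtain ⟨p, hp⟩ := CharP.exists F
  have : Fact p.Prime := ⟨CharP.char_is_prime F p⟩
  have : NeZero n := ⟨hn⟩
  obtain ⟨x, hx⟩ := Field.exists_primitive_element F (FiniteField.Extension F p n)
  have hint : IsIntegral F x := IsIntegral.of_finite F x
  refine ⟨minpoly F x, minpoly.monic hint, minpoly.irreducible hint, ?_⟩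
  rw [(Field.primitive_element_iff_minpoly_natDegree_eq F x).1 hx,
    FiniteField.finrank_extension]

theorem MvPolynomial.coeff_prod_aeval_X {R S σ : Type*} [CommSemiring R] [CommSemiring S]
    [Algebra R S] [Fintype σ] (p : Polynomial R) (m : σ →₀ ℕ) :
    coeff m (∏ i : σ, Polynomial.aeval (X i : MvPolynomial σ S) p) =
      ∏ i, algebraMap R S (p.coeff (m i)) := by
  classical
  have hN : ∀ i, m i < p.natDegree + ∑ j, m j + 1 := fun i => by
    have := Finset.single_le_sum (f := fun j => m j) (fun _ _ => Nat.zero_le _)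
      (Finset.mem_univ i)
    lia
  set N := p.natDegree + ∑ j, m j + 1
  have hsum : ∀ i : σ, Polynomial.aeval (X i : MvPolynomial σ S) p =
      ∑ j ∈ Finset.range N, C (algebraMap R S (p.coeff j)) * X i ^ j := fun i => by
    rw [Polynomial.aeval_eq_sum_range' (show p.natDegree < N by lia)]
    refine Finset.sum_congr rfl fun j _ => ?_
    rw [Algebra.smul_def, IsScalarTower.algebraMap_apply R S, algebraMap_eq]
  simp_rw [hsum, Finset.prod_univ_sum, coeff_sum, Finset.prod_mul_distrib, ← map_prod,
    coeff_C_mul, coeff_prod_X_pow]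
  rw [Finset.sum_eq_single (m : σ → ℕ)]
  · rw [if_pos (by ext; simp), mul_one]
  · intro f _ hf
    rw [if_neg, mul_zero]
    rintro rfl
    exact hf (by ext; simp)
  · intro h
    exact absurd (Fintype.mem_piFinset.2 fun i => Finset.mem_range.2 (hN i)) h

section MonicOf

variable {F : Type*} [Field F] {d : ℕ}

theorem coeff_monicOf (c : Fin d → F) (j : ℕ) :
    (monicOf F d c).coeff j =
      if h : j < d then c ⟨j, h⟩ else if j = d then 1 else 0 := by
  simp only [monicOf, Polynomial.coeff_add, Polynomial.coeff_X_pow, Polynomial.finsetSum_coeff,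
    Polynomial.coeff_C_mul, mul_ite, mul_one, mul_zero]
  split_ifs with h h' h'
  · lia
  · rw [Finset.sum_eq_zero, add_zero]
    intro i _
    rw [if_neg (by lia)]
  · rw [zero_add, Finset.sum_eq_single ⟨j, h'⟩] <;> simp +contextual [Fin.ext_iff, eq_comm]
  · rw [Finset.sum_eq_zero, add_zero]
    intro i _
    rw [if_neg (by lia)]

theorem monicOf_injective : Function.Injective (monicOf F d) := by
  intro c c' h
  ext i
  have := congrArg (fun p => Polynomial.coeff p (i : ℕ)) h
  simpa [coeff_monicOf] using this

theorem natDegree_monicOf (c : Fin d → F) : (monicOf F d c).natDegree = d := by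
  refine Polynomial.natDegree_eq_of_le_of_coeff_ne_zero ?_ (by simp [coeff_monicOf])
  refine Polynomial.natDegree_le_iff_coeff_eq_zero.2 fun j hj => ?_
  rw [coeff_monicOf, dif_neg (by lia), if_neg (by lia)]

theorem monic_monicOf (c : Fin d → F) : (monicOf F d c).Monic := by
  rw [Polynomial.Monic, Polynomial.leadingCoeff, natDegree_monicOf, coeff_monicOf]
  simp

theorem exists_monicOf_eq {p : Polynomial F} (hp : p.Monic) (hd : p.natDegree = d) :
    ∃ c, monicOf F d c = p := by
  refine ⟨fun i => p.coeff i, ?_⟩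
  ext j
  rw [coeff_monicOf]
  split_ifs with h h'
  · rfl
  · rw [h', ← hd, hp.coeff_natDegree]
  · rw [Polynomial.coeff_eq_zero_of_natDegree_lt (by lia)]

/-- The power sum `∑ a^{-α}` over monic polynomials `a` of degree `d` does not vanish: for a
monic irreducible `P` of degree `d`, the only summand with a pole at `P` is `P^{-α}`. -/
theorem sum_inv_monicOf_pow_ne_zero [Fintype F] {α : ℕ} (hα : α ≠ 0) :
    ∑ c : Fin d → F, (algebraMap (Polynomial F) (RatFunc F) (monicOf F d c))⁻¹ ^ α ≠ 0 := by
  classical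
  rcases eq_or_ne d 0 with rfl | hd
  · simp [monicOf]
  obtain ⟨P, hPm, hPi, hPd⟩ := FiniteField.exists_monic_irreducible_natDegree_eq F hd
  obtain ⟨c₀, hc₀⟩ := exists_monicOf_eq hPm hPd
  intro h
  have hne : ∀ c : Fin d → F, algebraMap (Polynomial F) (RatFunc F) (monicOf F d c) ≠ 0 :=
    fun c => RatFunc.algebraMap_ne_zero (monic_monicOf c).ne_zero
  have hpoly : ∑ c : Fin d → F, ∏ c' ∈ Finset.univ.erase c, monicOf F d c' ^ α = 0 := by
    apply RatFunc.algebraMap_injective F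
    rw [map_zero, map_sum,
      ← mul_zero (∏ c : Fin d → F, algebraMap (Polynomial F) (RatFunc F) (monicOf F d c) ^ α),
      ← h, Finset.mul_sum]
    refine Finset.sum_congr rfl fun c _ => ?_
    rw [← Finset.mul_prod_erase _ _ (Finset.mem_univ c), mul_right_comm, ← mul_pow,
      mul_inv_cancel₀ (hne c), one_pow, one_mul, map_prod]
    simp_rw [map_pow]
  rw [← Finset.add_sum_erase _ _ (Finset.mem_univ c₀)] at hpoly
  have hrest : P ∣ ∑ c ∈ Finset.univ.erase c₀,
      ∏ c' ∈ Finset.univ.erase c, monicOf F d c' ^ α := by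
    refine Finset.dvd_sum fun c hc => ?_
    refine dvd_trans ?_ (Finset.dvd_prod_of_mem _
      (Finset.mem_erase.2 ⟨(Finset.ne_of_mem_erase hc).symm, Finset.mem_univ c₀⟩))
    rw [hc₀]
    exact dvd_pow_self P hα
  have hdvd := (dvd_add_left hrest).1 (hpoly ▸ dvd_zero P)
  obtain ⟨c, hc, hPc⟩ := (hPi.prime.dvd_finsetProd_iff _).1 hdvd
  have heq := Polynomial.eq_of_monic_of_dvd_of_natDegree_le hPm (monic_monicOf c)
    (hPi.prime.dvd_of_dvd_pow hPc) (by rw [natDegree_monicOf, hPd])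
  exact Finset.ne_of_mem_erase hc (monicOf_injective (heq.trans hc₀.symm))

theorem coeff_SdsK [Fintype F] (d s α : ℕ) (m : Fin s →₀ ℕ) :
    (SdsK F d s α).coeff m = ∑ c : Fin d → F,
      (algebraMap (Polynomial F) (RatFunc F) (monicOf F d c))⁻¹ ^ α *
        ∏ i, algebraMap F (RatFunc F) ((monicOf F d c).coeff (m i)) := by
  simp_rw [SdsK, MvPolynomial.coeff_sum, MvPolynomial.coeff_C_mul,
    MvPolynomial.coeff_prod_aeval_X]

theorem coeff_SdsK_eq_zero [Fintype F] {d s : ℕ} (α : ℕ) {m : Fin s →₀ ℕ} {i : Fin s}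
    (hi : d < m i) : (SdsK F d s α).coeff m = 0 := by
  rw [coeff_SdsK]
  refine Finset.sum_eq_zero fun c _ => ?_
  rw [Finset.prod_eq_zero (Finset.mem_univ i), mul_zero]
  rw [Polynomial.coeff_eq_zero_of_natDegree_lt (by rwa [natDegree_monicOf]), map_zero]

end MonicOf

/-- For `s ≥ 1`, `α ≥ 1`, `k ≥ 0`, the polynomial `∑_{d=0}^{k} S_{d,s}(−α)`
has total degree exactly `ks`. -/
theorem totalDegree_sum_SdsK (F : Type*) [Field F] [Fintype F] (s α k : ℕ)
    (hs : 1 ≤ s) (hα : 1 ≤ α) :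
    (∑ d ∈ Finset.range (k + 1), SdsK F d s α).totalDegree = k * s := by
  apply le_antisymm
  · refine Finset.sup_le fun m hm => ?_
    have hmk : ∀ i, m i ≤ k := by
      by_contra! ⟨i, hi⟩
      rw [MvPolynomial.mem_support_iff, MvPolynomial.coeff_sum] at hm
      refine hm (Finset.sum_eq_zero fun d hd => coeff_SdsK_eq_zero α (i := i) ?_)
      have := Finset.mem_range.1 hd
      lia
    rw [Finsupp.sum_fintype _ _ fun _ => rfl]
    simpa [mul_comm] using Finset.sum_le_sum fun i (_ : i ∈ Finset.univ) => hmk i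
  · set m : Fin s →₀ ℕ := Finsupp.equivFunOnFinite.symm fun _ => k
    have hm : ∀ i, m i = k := fun _ => rfl
    have hsupp : m ∈ (∑ d ∈ Finset.range (k + 1), SdsK F d s α).support := by
      rw [MvPolynomial.mem_support_iff, MvPolynomial.coeff_sum, Finset.sum_range_succ,
        Finset.sum_eq_zero fun d hd =>
          coeff_SdsK_eq_zero α (i := ⟨0, hs⟩) ((hm _).symm ▸ Finset.mem_range.1 hd),
        zero_add, coeff_SdsK]
      simpa [hm, coeff_monicOf] using
        sum_inv_monicOf_pow_ne_zero (F := F) (d := k) (Nat.one_le_iff_ne_zero.1 hα)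
    refine le_trans (le_of_eq ?_) (MvPolynomial.le_totalDegree hsupp)
    rw [Finsupp.sum_fintype _ _ fun _ => rfl]
    simp [hm, mul_comm]
end

section
/- Let s, α be integers with s ≥ 1, α ≥ 1 and s ≡ α (mod q−1). Let δ ≥ 1 be the smallest positive integer such that q^δ ≥ α and s + ℓ_q(q^δ − α) ≥ 2. Let k ≥ 1 be an integer with k(q−1) ≥ s + ℓ_q(q^δ − α), and set N = δ + k − ⌈(s + ℓ_q(q^δ − α))/(q−1)⌉. Then the product ∏_{i=1}^{s} ∏_{j=δ}^{N} (t_i − θ^{q^j}) divides ∑_{d=0}^{k} S_{d,s}(−α) in K[t₁,…,t_s] (if N < δ the product is empty and equals 1). -/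
open Polynomial in
/-- A sum over `Fˡ` of a product of fewer than `l (q - 1)` linear forms vanishes. -/
theorem sum_prod_aeval_eq_zero {F R ι : Type*} [Field F] [Fintype F] [CommRing R] [Algebra F R]
    [Fintype ι] (x : ι → R) (l : ℕ) (h : Fintype.card ι < (Fintype.card F - 1) * l) :
    ∑ c : Fin l → F, ∏ i, aeval (x i) (∑ j : Fin l, C (c j) * X ^ (j : ℕ)) = 0 := by
  classical
  have monomial_sum (f : ι → Fin l) : ∑ c : Fin l → F, ∏ i, c (f i) = 0 := by
    have hdeg : (∏ i, (MvPolynomial.X (f i) : MvPolynomial (Fin l) F)).totalDegree <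
        (Fintype.card F - 1) * Fintype.card (Fin l) := by
      refine (MvPolynomial.totalDegree_finsetProd _ _).trans_lt ?_
      simpa using h
    simpa using MvPolynomial.sum_eval_eq_zero _ hdeg
  simp only [map_sum, map_mul, aeval_C, map_pow, aeval_X, Fintype.prod_sum,
    Finset.prod_mul_distrib]
  rw [Finset.sum_comm]
  refine Finset.sum_eq_zero fun f _ ↦ ?_
  rw [← Finset.sum_mul]
  simp only [← map_prod, ← map_sum, monomial_sum, map_zero, zero_mul]

open Polynomial in
/-- For a function `g` on polynomials invariant under scaling and vanishing at `0`, the sum of `g`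
over all polynomials of degree `< l` is minus its sum over the monic ones. -/
theorem sum_monicOf_eq_neg {F R : Type*} [Field F] [Fintype F] [CommRing R] [Algebra F R]
    (g : F[X] → R) (g_zero : g 0 = 0) (g_smul : ∀ u : F, u ≠ 0 → ∀ a, g (C u * a) = g a) (l : ℕ) :
    ∑ d ∈ Finset.range l, ∑ c : Fin d → F, g (monicOf F d c) =
      -∑ c : Fin l → F, g (∑ j : Fin l, C (c j) * X ^ (j : ℕ)) := by
  classical
  induction l with
  | zero => simp [g_zero]
  | succ l ih =>
    have leading_coeff (u : F) (hu : u ≠ 0) :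
        ∑ c : Fin l → F, g (∑ j : Fin l, C (c j) * X ^ (j : ℕ) + C u * X ^ l) =
          ∑ c : Fin l → F, g (monicOf F l c) := by
      refine (Fintype.sum_equiv (Equiv.piCongrRight fun _ ↦ Equiv.mulLeft₀ u hu) _ _
        fun c ↦ ?_).symm
      rw [← g_smul u hu]
      congr 1
      simp [monicOf, mul_add, Finset.mul_sum, mul_assoc, add_comm]
    have card_cast : ((Fintype.card F : ℕ) : R) = 0 := by
      rw [← map_natCast (algebraMap F R), FiniteField.cast_card_eq_zero, map_zero]
    rw [Finset.sum_range_succ, ih,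
      ← (Fin.snocEquiv fun _ : Fin (l + 1) ↦ F).sum_comp, Fintype.sum_prod_type,
      ← Finset.add_sum_erase _ _ (Finset.mem_univ (0 : F))]
    simp only [Fin.sum_univ_castSucc, Fin.snocEquiv_apply, Fin.snoc_castSucc, Fin.snoc_last,
      Fin.val_castSucc, Fin.val_last]
    rw [Finset.sum_congr rfl fun u hu ↦ leading_coeff u (Finset.ne_of_mem_erase hu),
      Finset.sum_const, Finset.card_erase_of_mem (Finset.mem_univ _), Finset.card_univ,
      nsmul_eq_mul, Nat.cast_pred Fintype.card_pos, card_cast]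
    simp [add_comm]

theorem lq_zero (q : ℕ) : lq q 0 = 0 := by simp [lq]

theorem lq_eq_mod_add {q : ℕ} (hq : 1 < q) (n : ℕ) : lq q n = n % q + lq q (n / q) := by
  rcases n.eq_zero_or_pos with rfl | hn
  · simp [lq]
  · simp [lq, Nat.digits_def' hq hn]

theorem lq_add_mul_pow {q : ℕ} (hq : 1 < q) {c : ℕ} (hc : c < q) (j : ℕ) :
    ∀ r < q ^ j, lq q (r + c * q ^ j) = lq q r + c := by
  induction j with
  | zero =>
    intro r hr
    obtain rfl : r = 0 := by simpa using hr
    rw [pow_zero, mul_one, zero_add, lq_eq_mod_add hq, Nat.mod_eq_of_lt hc,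
      Nat.div_eq_of_lt hc, lq_zero, add_zero, zero_add]
  | succ j ih =>
    intro r hr
    have hdiv : r / q < q ^ j := Nat.div_lt_of_lt_mul (by rwa [pow_succ'] at hr)
    rw [lq_eq_mod_add hq, lq_eq_mod_add hq r, pow_succ, ← mul_assoc, Nat.add_mul_mod_self_right,
      Nat.add_mul_div_right _ _ (by lia), ih _ hdiv, add_assoc]

theorem lq_pow_sub {q : ℕ} (hq : 1 < q) {α δ : ℕ} (hα : 1 ≤ α) (hδ : α ≤ q ^ δ) (i : ℕ) :
    lq q (q ^ (δ + i) - α) = lq q (q ^ δ - α) + i * (q - 1) := by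
  induction i with
  | zero => simp
  | succ i ih =>
    have hle : α ≤ q ^ (δ + i) := hδ.trans (Nat.pow_le_pow_right (by lia) (by lia))
    have split_pow : q ^ (δ + (i + 1)) - α =
        (q ^ (δ + i) - α) + (q - 1) * q ^ (δ + i) := by
      rw [← add_assoc, pow_succ', Nat.sub_mul, one_mul]
      have : q ^ (δ + i) ≤ q * q ^ (δ + i) := Nat.le_mul_of_pos_left _ (by lia)
      lia
    rw [split_pow, lq_add_mul_pow hq (by lia) _ _ (by lia), ih]
    ring

open Polynomial in
theorem aeval_pow_card_pow {F R : Type*} [Field F] [Fintype F] [CommRing R] [Algebra F R]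
    (y : R) (j : ℕ) (a : F[X]) :
    aeval (y ^ Fintype.card F ^ j) a = aeval y a ^ Fintype.card F ^ j := by
  induction j with
  | zero => simp
  | succ j ih =>
    rw [pow_succ, pow_mul, ← expand_aeval, FiniteField.expand_card, map_pow, ih, ← pow_mul]

open Polynomial in
/-- Over a finite field, `a(y) ^ m` is a product of `ℓ_q(m)` values of the polynomial `a`. -/
theorem exists_pow_eq_prod_aeval {F R : Type*} [Field F] [Fintype F] [CommRing R] [Algebra F R]
    (m : ℕ) : ∀ y : R, ∃ x : Fin (lq (Fintype.card F) m) → R,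
      ∀ a : F[X], aeval y a ^ m = ∏ i, aeval (x i) a := by
  have hq : 1 < Fintype.card F := Fintype.one_lt_card
  induction m using Nat.strong_induction_on with
  | _ m ih =>
    intro y
    rcases m.eq_zero_or_pos with rfl | hm
    · rw [lq_zero]
      exact ⟨Fin.elim0, by simp⟩
    · obtain ⟨x, hx⟩ := ih (m / Fintype.card F) (Nat.div_lt_self hm hq) (y ^ Fintype.card F)
      rw [lq_eq_mod_add hq]
      refine ⟨Fin.append (fun _ ↦ y) x, fun a ↦ ?_⟩
      rw [Fin.prod_univ_add]
      simp only [Fin.append_left, Fin.append_right, ← hx]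
      rw [← expand_aeval, FiniteField.expand_card, map_pow, ← pow_mul, Finset.prod_const,
        Finset.card_univ, Fintype.card_fin, ← pow_add, Nat.mod_add_div]

open Polynomial in
/-- Vanishing of the sum over monic polynomials of degree `< l` of a product of evaluations and
a power of an evaluation. -/
theorem sum_monicOf_prod_mul_pow_eq_zero {F R ι : Type*} [Field F] [Fintype F] [CommRing R]
    [Algebra F R] [Fintype ι] (x : ι → R) (y : R) (m l : ℕ)
    (hdvd : Fintype.card F - 1 ∣ Fintype.card ι + m)
    (hpos : 0 < Fintype.card ι + lq (Fintype.card F) m)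
    (hlt : Fintype.card ι + lq (Fintype.card F) m < (Fintype.card F - 1) * l) :
    ∑ d ∈ Finset.range l, ∑ c : Fin d → F,
      (∏ i, aeval (x i) (monicOf F d c)) * aeval y (monicOf F d c) ^ m = 0 := by
  obtain ⟨z, hz⟩ := exists_pow_eq_prod_aeval (F := F) m y
  have prod_eq (a : F[X]) : (∏ i, aeval (x i) a) * aeval y a ^ m =
      ∏ i, aeval (Sum.elim x z i) a := by
    simp [Fintype.prod_sum_type, hz]
  rw [sum_monicOf_eq_neg (fun a ↦ (∏ i, aeval (x i) a) * aeval y a ^ m)]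
  · simp only [prod_eq]
    rw [sum_prod_aeval_eq_zero _ _ (by simpa using hlt), neg_zero]
  · rw [prod_eq]
    simp only [map_zero, Finset.prod_const, Finset.card_univ, Fintype.card_sum, Fintype.card_fin]
    exact zero_pow hpos.ne'
  · intro u hu a
    have hpow : u ^ (Fintype.card ι + m) = 1 := by
      obtain ⟨e, he⟩ := hdvd
      rw [he, pow_mul, FiniteField.pow_card_sub_one_eq_one u hu, one_pow]
    simp only [map_mul, aeval_C, Finset.prod_mul_distrib, mul_pow, Finset.prod_const,
      Finset.card_univ]
    rw [mul_mul_mul_comm, ← pow_add, ← map_pow, hpow, map_one, one_mul]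

theorem sub_one_dvd_add_pow_sub {q s α j : ℕ} (hq : 1 ≤ q) (hs : 1 ≤ s) (hα : α ≤ q ^ j)
    (hmod : s ≡ α [MOD q - 1]) : q - 1 ∣ s - 1 + (q ^ j - α) := by
  have pow_dvd : q - 1 ∣ q ^ j - 1 := by simpa using Nat.sub_dvd_pow_sub_pow q 1 j
  have one_le : 1 ≤ q ^ j := Nat.one_le_pow _ _ hq
  have sub_dvd := dvd_sub (Int.natCast_dvd_natCast.mpr pow_dvd) hmod.dvd
  rw [← Int.natCast_dvd_natCast]
  rwa [show ((s - 1 + (q ^ j - α) : ℕ) : ℤ) = (q ^ j - 1 : ℕ) - ((α : ℤ) - s) by lia]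

theorem monicOf_ne_zero {F : Type*} [Field F] (d : ℕ) (c : Fin d → F) : monicOf F d c ≠ 0 :=
  (Polynomial.monic_X_pow_add (Polynomial.degree_sum_fin_lt c)).ne_zero

theorem MvPolynomial.irreducible_X_sub_C {σ K : Type*} [Field K] (i : σ) (b : K) :
    Irreducible (X i - C b : MvPolynomial σ K) := by
  have := irreducible_mul_X_add (1 : MvPolynomial σ K) (-C b) i one_ne_zero
    (by simp) (by rw [← map_neg, vars_C]; simp) isRelPrime_one_left
  simpa [sub_eq_add_neg] using this

theorem MvPolynomial.isRelPrime_X_sub_C {σ K : Type*} [Field K] {i i' : σ} {b b' : K}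
    (h : (i, b) ≠ (i', b')) :
    IsRelPrime (X i - C b : MvPolynomial σ K) (X i' - C b') := by
  classical
  rw [(irreducible_X_sub_C i b).isRelPrime_iff_not_dvd]
  intro hdvd
  have heval := map_dvd (eval (Function.update (fun _ ↦ b' + 1) i b)) hdvd
  simp only [map_sub, eval_X, eval_C, Function.update_self, sub_self, zero_dvd_iff] at heval
  by_cases hi : i' = i
  · subst hi
    rw [Function.update_self, sub_eq_zero] at heval
    exact h (by rw [heval])
  · simp [Function.update_of_ne hi] at heval

/-- Substituting `θ ^ q ^ j` for `t_i` annihilates `∑_{d ≤ k} S_{d,s}(-α)`. -/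
theorem X_sub_C_dvd_sum_SdsK {F : Type*} [Field F] [Fintype F] {s α j k : ℕ} (i : Fin s)
    (hmod : s ≡ α [MOD Fintype.card F - 1]) (hα : α ≤ Fintype.card F ^ j)
    (hpos : 2 ≤ s + lq (Fintype.card F) (Fintype.card F ^ j - α))
    (hlt : s + lq (Fintype.card F) (Fintype.card F ^ j - α) ≤ k * (Fintype.card F - 1)) :
    (MvPolynomial.X i - MvPolynomial.C
      (algebraMap (Polynomial F) (RatFunc F) (Polynomial.X ^ Fintype.card F ^ j))) ∣
      ∑ d ∈ Finset.range (k + 1), SdsK F d s α := by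
  classical
  set q := Fintype.card F with hq
  have one_lt_q : 1 < q := Fintype.one_lt_card
  rw [← Ideal.Quotient.eq_zero_iff_dvd]
  set I := Ideal.span {(MvPolynomial.X i - MvPolynomial.C
    (algebraMap (Polynomial F) (RatFunc F) (Polynomial.X ^ q ^ j)) :
      MvPolynomial (Fin s) (RatFunc F))}
  let mk : MvPolynomial (Fin s) (RatFunc F) →ₐ[F] _ := Ideal.Quotient.mkₐ F I
  let ψ : RatFunc F →ₐ[F] (MvPolynomial (Fin s) (RatFunc F) ⧸ I) :=
    mk.comp (IsScalarTower.toAlgHom F (RatFunc F) (MvPolynomial (Fin s) (RatFunc F)))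
  have s_pos : 1 ≤ s := i.pos
  have mk_C (b : RatFunc F) : mk (MvPolynomial.C b) = ψ b := rfl
  have mk_X : mk (MvPolynomial.X i) =
      ψ (algebraMap (Polynomial F) (RatFunc F) (Polynomial.X ^ q ^ j)) := by
    refine Ideal.Quotient.eq.mpr ?_
    exact Ideal.mem_span_singleton_self _
  have algebraMap_eq (a : Polynomial F) : algebraMap (Polynomial F) (RatFunc F) a =
      Polynomial.aeval (RatFunc.X : RatFunc F) a := by
    rw [← RatFunc.algebraMap_X, Polynomial.aeval_algebraMap_apply, Polynomial.aeval_X_left_apply]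
  have aeval_X (a : Polynomial F) : Polynomial.aeval (mk (MvPolynomial.X i)) a =
      ψ (algebraMap (Polynomial F) (RatFunc F) a ^ q ^ j) := by
    rw [mk_X, Polynomial.aeval_algHom_apply, map_pow, aeval_pow_card_pow,
      RatFunc.algebraMap_X, ← algebraMap_eq]
  have summand (d : ℕ) (c : Fin d → F) :
      mk (MvPolynomial.C ((algebraMap (Polynomial F) (RatFunc F) (monicOf F d c))⁻¹ ^ α) *
        ∏ i : Fin s, Polynomial.aeval (MvPolynomial.X i) (monicOf F d c)) =
      (∏ i' : {i' // i' ≠ i}, Polynomial.aeval (mk (MvPolynomial.X i'.1)) (monicOf F d c)) *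
        Polynomial.aeval (ψ RatFunc.X) (monicOf F d c) ^ (q ^ j - α) := by
    have hne : algebraMap (Polynomial F) (RatFunc F) (monicOf F d c) ≠ 0 :=
      RatFunc.algebraMap_ne_zero (monicOf_ne_zero d c)
    rw [map_mul, map_prod, ← Finset.mul_prod_erase _ _ (Finset.mem_univ i), ← mul_assoc, mul_comm]
    congr 1
    · simp only [Polynomial.aeval_algHom_apply]
      exact (Finset.prod_subtype _ (by simp) _)
    · rw [← Polynomial.aeval_algHom_apply, aeval_X, Polynomial.aeval_algHom_apply,
        ← algebraMap_eq, ← map_pow ψ, mk_C, ← map_mul, pow_sub₀ _ hne hα, inv_pow, mul_comm]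
  change mk _ = 0
  simp only [map_sum, SdsK, summand]
  refine sum_monicOf_prod_mul_pow_eq_zero _ _ _ _ ?_ ?_ ?_
  · simpa [← hq] using sub_one_dvd_add_pow_sub one_lt_q.le s_pos hα hmod
  · simp [← hq]
    lia
  · simp [← hq, mul_comm]
    lia

/-- Let `s ≡ α (mod q−1)`, `s, α ≥ 1`, let `δ ≥ 1` be the smallest positive integer with
`q^δ ≥ α` and `s + ℓ_q(q^δ − α) ≥ 2`, let `k ≥ 1` satisfy `k(q−1) ≥ s + ℓ_q(q^δ − α)`, and
set `N = δ + k − ⌈(s + ℓ_q(q^δ − α))/(q−1)⌉`.  Then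
`∏_{i=1}^{s} ∏_{j=δ}^{N} (t_i − θ^{q^j})` divides `∑_{d=0}^{k} S_{d,s}(−α)` in `K[t₁,…,t_s]`. -/
theorem prod_Icc_dvd_sum_SdsK (F : Type*) [Field F] [Fintype F] (q : ℕ)
    (hq : Fintype.card F = q) (s α δ k : ℕ) (hs : 1 ≤ s) (hα : 1 ≤ α)
    (hmod : s ≡ α [MOD q - 1])
    (hδ1 : 1 ≤ δ) (hδ2 : α ≤ q ^ δ) (hδ3 : 2 ≤ s + lq q (q ^ δ - α))
    (hδmin : ∀ δ' : ℕ, 1 ≤ δ' → α ≤ q ^ δ' → 2 ≤ s + lq q (q ^ δ' - α) → δ ≤ δ')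
    (hk1 : 1 ≤ k) (hk2 : s + lq q (q ^ δ - α) ≤ k * (q - 1)) :
    (∏ i : Fin s, ∏ j ∈ Finset.Icc δ (δ + k - (s + lq q (q ^ δ - α)) ⌈/⌉ (q - 1)),
        (MvPolynomial.X i -
          MvPolynomial.C (algebraMap (Polynomial F) (RatFunc F) (Polynomial.X ^ q ^ j)))) ∣
      ∑ d ∈ Finset.range (k + 1), SdsK F d s α := by
  subst hq
  have hq : 1 < Fintype.card F := Fintype.one_lt_card
  set L := s + lq (Fintype.card F) (Fintype.card F ^ δ - α) with hL
  have ceil_mul : L ≤ (Fintype.card F - 1) * (L ⌈/⌉ (Fintype.card F - 1)) :=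
    (ceilDiv_le_iff_le_mul (by lia)).mp le_rfl
  have ceil_le : L ⌈/⌉ (Fintype.card F - 1) ≤ k :=
    (ceilDiv_le_iff_le_mul (by lia)).mpr (by rwa [mul_comm])
  rw [← Finset.univ.prod_product' _ fun (i : Fin s) (j : ℕ) ↦ (MvPolynomial.X i - MvPolynomial.C
    (algebraMap (Polynomial F) (RatFunc F) (Polynomial.X ^ Fintype.card F ^ j)))]
  refine Finset.prod_dvd_of_isRelPrime ?_ ?_
  · rintro ⟨i, j⟩ - ⟨i', j'⟩ - hne
    refine MvPolynomial.isRelPrime_X_sub_C fun h ↦ hne ?_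
    simp only [Prod.mk.injEq] at h ⊢
    refine ⟨h.1, Nat.pow_right_injective hq ?_⟩
    simpa using congrArg Polynomial.natDegree (RatFunc.algebraMap_injective F h.2)
  · rintro ⟨i, j⟩ hij
    obtain ⟨hj₁, hj₂⟩ := Finset.mem_Icc.mp (Finset.mem_product.mp hij).2
    obtain ⟨e, rfl⟩ := Nat.exists_eq_add_of_le hj₁
    have lq_eq := lq_pow_sub hq hα hδ2 e
    refine X_sub_C_dvd_sum_SdsK i hmod
      (hδ2.trans (Nat.pow_le_pow_right (by lia) (by lia))) (by lia) ?_
    have mul_le := Nat.mul_le_mul_left (Fintype.card F - 1)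
      (show L ⌈/⌉ (Fintype.card F - 1) + e ≤ k by lia)
    rw [lq_eq]
    nlinarith
end
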